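/- (Proposition 3.) Let φ be a ∀* HyperLTL formula (all quantifiers universal) and let 𝒫 ⊆ SymPaths(Q) be a finite set of satisfiable (not necessarily maximal) symbolic paths of a program Q. If the formula enc^φ_𝒫 is not valid, then Q ⊭ φ. -/

import Mathlib

namespace HyRep

/-- A (concrete) store maps program variables to integers. -/
abbrev Store (X : Type) := X → ℤ

/-- Programs of the simple while-language (with shallowly embedded integer
and Boolean expressions over the variables `X`). -/
inductive Prog (X : Type) : Type where
  | skip : Prog X
  | assign (x : X) (e : Store X → ℤ) : Prog X
  | ite (b : Store X → Bool) (p q : Prog X) : Prog X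
  | whileLoop (b : Store X → Bool) (p : Prog X) : Prog X
  | seq (p q : Prog X) : Prog X
  | observe : Prog X

/-- A configuration is a program together with a store. -/
abbrev Config (X : Type) := Prog X × Store X

/-- The labelled small-step semantics: the label `none` is the silent label ε,
while `some σ` is the observation of the store `σ` (emitted by `observe`). -/
inductive Step {X : Type} [DecidableEq X] :
    Config X → Option (Store X) → Config X → Prop where
  | assign {x : X} {e : Store X → ℤ} {σ : Store X} :
      Step (.assign x e, σ) none (.skip, Function.update σ x (e σ))
  | observe {σ : Store X} : Step (.observe, σ) (some σ) (.skip, σ)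
  | iteTrue {b : Store X → Bool} {p q : Prog X} {σ : Store X} (h : b σ = true) :
      Step (.ite b p q, σ) none (p, σ)
  | iteFalse {b : Store X → Bool} {p q : Prog X} {σ : Store X} (h : b σ = false) :
      Step (.ite b p q, σ) none (q, σ)
  | whileTrue {b : Store X → Bool} {p : Prog X} {σ : Store X} (h : b σ = true) :
      Step (.whileLoop b p, σ) none (.seq p (.whileLoop b p), σ)
  | whileFalse {b : Store X → Bool} {p : Prog X} {σ : Store X} (h : b σ = false) :
      Step (.whileLoop b p, σ) none (.skip, σ)
  | seqSkip {p : Prog X} {σ : Store X} : Step (.seq .skip p, σ) none (p, σ)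
  | seqStep {p p' q : Prog X} {σ σ' : Store X} {μ : Option (Store X)}
      (h : Step (p, σ) μ (p', σ')) : Step (.seq p q, σ) μ (.seq p' q, σ')

/-- An execution from configuration `C`: a (finite or infinite) sequence of
labelled small steps.  `len : ℕ∞` is the number of steps; `cfg i` is the `i`-th
configuration and `lbl i` the label of the step from `cfg i` to `cfg (i+1)`
(the values of `cfg`/`lbl` beyond `len` are irrelevant). -/
structure Exec {X : Type} [DecidableEq X] (C : Config X) where
  len : ℕ∞
  cfg : ℕ → Config X
  lbl : ℕ → Option (Store X)
  init : cfg 0 = C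
  step : ∀ i : ℕ, (i : ℕ∞) + 1 ≤ len → Step (cfg i) (lbl i) (cfg (i + 1))

/-- An execution is maximal if it is infinite or ends in a configuration whose
program component is `skip`. -/
def Exec.Maximal {X : Type} [DecidableEq X] {C : Config X} (ρ : Exec C) : Prop :=
  ρ.len = ⊤ ∨ ∃ n : ℕ, ρ.len = (n : ℕ∞) ∧ (ρ.cfg n).1 = Prog.skip

/-- The indices (within the length of the execution) at which an observation
(a non-ε label) is emitted. -/
def Exec.ObsIdx {X : Type} [DecidableEq X] {C : Config X} (ρ : Exec C) : ℕ → Prop :=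
  fun i => (i : ℕ∞) + 1 ≤ ρ.len ∧ (ρ.lbl i).isSome

/-- A (finite or infinite) trace: a sequence of stores of length `len`
(values of `get` beyond `len` are irrelevant). -/
structure Trace (X : Type) where
  len : ℕ∞
  get : ℕ → Store X

open Classical in
/-- The observation sequence of an execution: the sequence of observed stores,
obtained by removing all ε labels. -/
noncomputable def Exec.obs {X : Type} [DecidableEq X] {C : Config X}
    (ρ : Exec C) : Trace X where
  len := if h : {i | ρ.ObsIdx i}.Finite then (h.toFinset.card : ℕ∞) else ⊤
  get := fun k => (ρ.lbl (Nat.nth ρ.ObsIdx k)).getD (fun _ => 0)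

open Classical in
/-- The observation sequence `obs(P, σ)` along the (unique) maximal execution
from `⟨P, σ⟩`. -/
noncomputable def obsTrace {X : Type} [DecidableEq X] (P : Prog X) (σ : Store X) :
    Trace X :=
  if h : ∃ ρ : Exec (P, σ), ρ.Maximal then h.choose.obs else ⟨0, fun _ _ => 0⟩

/-- `Traces(P)`: the set of observation sequences of maximal executions of `P`. -/
def Traces {X : Type} [DecidableEq X] (P : Prog X) : Set (Trace X) :=
  { t | ∃ (σ : Store X) (ρ : Exec (P, σ)), ρ.Maximal ∧ t = ρ.obs }

/-- A program is terminating if all of its (maximal) executions are finite. -/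
def Terminating {X : Type} [DecidableEq X] (P : Prog X) : Prop :=
  ∀ (σ : Store X) (ρ : Exec (P, σ)), ρ.Maximal → ∃ n : ℕ, ρ.len = (n : ℕ∞)

/-! ### Symbolic execution -/

/-- A symbolic store maps each variable to an (integer) expression over `X`. -/
abbrev SymStore (X : Type) := X → Store X → ℤ

/-- A path condition: a first-order condition on stores. -/
abbrev PathCond (X : Type) := Store X → Prop

/-- Symbolic configurations `⟨P, ν, α, β⟩`. -/
abbrev SymConfig (X : Type) := Prog X × SymStore X × PathCond X × List (SymStore X)

/-- Substitute the symbolic store `ν` into the integer expression `e`. -/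
def symEvalA {X : Type} (e : Store X → ℤ) (ν : SymStore X) : Store X → ℤ :=
  fun σ => e fun x => ν x σ

/-- Substitute the symbolic store `ν` into the Boolean expression `b`. -/
def symEvalB {X : Type} (b : Store X → Bool) (ν : SymStore X) : Store X → Bool :=
  fun σ => b fun x => ν x σ

/-- Small-step symbolic execution. -/
inductive SymStep {X : Type} [DecidableEq X] : SymConfig X → SymConfig X → Prop where
  | assign {x : X} {e : Store X → ℤ} {ν : SymStore X} {α : PathCond X}
      {β : List (SymStore X)} :
      SymStep (.assign x e, ν, α, β) (.skip, Function.update ν x (symEvalA e ν), α, β)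
  | observe {ν : SymStore X} {α : PathCond X} {β : List (SymStore X)} :
      SymStep (.observe, ν, α, β) (.skip, ν, α, β ++ [ν])
  | iteTrue {b : Store X → Bool} {p q : Prog X} {ν : SymStore X} {α : PathCond X}
      {β : List (SymStore X)} :
      SymStep (.ite b p q, ν, α, β) (p, ν, fun σ => α σ ∧ symEvalB b ν σ = true, β)
  | iteFalse {b : Store X → Bool} {p q : Prog X} {ν : SymStore X} {α : PathCond X}
      {β : List (SymStore X)} :
      SymStep (.ite b p q, ν, α, β) (q, ν, fun σ => α σ ∧ symEvalB b ν σ = false, β)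
  | whileTrue {b : Store X → Bool} {p : Prog X} {ν : SymStore X} {α : PathCond X}
      {β : List (SymStore X)} :
      SymStep (.whileLoop b p, ν, α, β)
        (.seq p (.whileLoop b p), ν, fun σ => α σ ∧ symEvalB b ν σ = true, β)
  | whileFalse {b : Store X → Bool} {p : Prog X} {ν : SymStore X} {α : PathCond X}
      {β : List (SymStore X)} :
      SymStep (.whileLoop b p, ν, α, β) (.skip, ν, fun σ => α σ ∧ symEvalB b ν σ = false, β)
  | seqSkip {p : Prog X} {ν : SymStore X} {α : PathCond X} {β : List (SymStore X)} :
      SymStep (.seq .skip p, ν, α, β) (p, ν, α, β)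
  | seqStep {p p' q : Prog X} {ν ν' : SymStore X} {α α' : PathCond X}
      {β β' : List (SymStore X)} (h : SymStep (p, ν, α, β) (p', ν', α', β')) :
      SymStep (.seq p q, ν, α, β) (.seq p' q, ν', α', β')

/-- The initial symbolic store `ν₀`, mapping each variable to itself. -/
def initSym {X : Type} : SymStore X := fun x σ => σ x

/-- A symbolic path: a path condition together with a symbolic observation sequence. -/
abbrev SymPath (X : Type) := PathCond X × List (SymStore X)

/-- `(α, β)` is a symbolic path of `P`: it is reached by some finite symbolic
execution starting from `⟨P, ν₀, true, ε⟩`. -/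
def IsSymPath {X : Type} [DecidableEq X] (P : Prog X) (p : SymPath X) : Prop :=
  ∃ (P' : Prog X) (ν : SymStore X),
    Relation.ReflTransGen SymStep (P, initSym, fun _ => True, []) (P', ν, p.1, p.2)

/-- `(α, β)` is a maximal symbolic path of `P`: the reached program is `skip`. -/
def IsMaxSymPath {X : Type} [DecidableEq X] (P : Prog X) (p : SymPath X) : Prop :=
  ∃ ν : SymStore X,
    Relation.ReflTransGen SymStep (P, initSym, fun _ => True, []) (.skip, ν, p.1, p.2)

/-- `SymPaths(P)`: all satisfiable symbolic paths of `P`. -/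
def SymPaths {X : Type} [DecidableEq X] (P : Prog X) : Set (SymPath X) :=
  { p | IsSymPath P p ∧ ∃ σ : Store X, p.1 σ }

/-- `SymPaths_max(P)`: all satisfiable maximal symbolic paths of `P`. -/
def SymPathsMax {X : Type} [DecidableEq X] (P : Prog X) : Set (SymPath X) :=
  { p | IsMaxSymPath P p ∧ ∃ σ : Store X, p.1 σ }

/-- Evaluate a symbolic observation sequence at a concrete store,
yielding a concrete observation sequence (a list of stores). -/
def evalObs {X : Type} (β : List (SymStore X)) (σ : Store X) : List (Store X) :=
  β.map fun ν x => ν x σ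

/-- Evaluate a symbolic observation sequence at a concrete store, as a trace. -/
def evalTrace {X : Type} (β : List (SymStore X)) (σ : Store X) : Trace X :=
  ⟨(β.length : ℕ∞), fun i x => (β.getD i initSym) x σ⟩

/-! ### HyperLTL -/

/-- Bodies of HyperLTL formulas over `n` trace variables: atoms are (shallowly
embedded) first-order predicates over the indexed variables `x_{π_j}` (i.e.,
predicates over one store per trace variable); negation occurs only inside
atoms, and the temporal operators are next `X` and weak-until `W`. -/
inductive LTLBody (X : Type) : ℕ → Type 1 where
  | atom {n : ℕ} (θ : (Fin n → Store X) → Prop) : LTLBody X n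
  | and {n : ℕ} (ψ₁ ψ₂ : LTLBody X n) : LTLBody X n
  | or {n : ℕ} (ψ₁ ψ₂ : LTLBody X n) : LTLBody X n
  | next {n : ℕ} (ψ : LTLBody X n) : LTLBody X n
  | wuntil {n : ℕ} (ψ₁ ψ₂ : LTLBody X n) : LTLBody X n

/-- Vacuous satisfaction: some bound trace is shorter than the current position. -/
def vac {X : Type} {n : ℕ} (Tr : Fin n → Trace X) (i : ℕ) : Prop :=
  ∃ j : Fin n, (Tr j).len ≤ (i : ℕ∞)

/-- Satisfaction `Π, i ⊨ ψ` of an LTL body on a trace assignment `Tr`. -/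
def BodySat {X : Type} {n : ℕ} (Tr : Fin n → Trace X) : LTLBody X n → ℕ → Prop
  | .atom θ => fun i => vac Tr i ∨ θ fun j => (Tr j).get i
  | .and ψ₁ ψ₂ => fun i => vac Tr i ∨ (BodySat Tr ψ₁ i ∧ BodySat Tr ψ₂ i)
  | .or ψ₁ ψ₂ => fun i => vac Tr i ∨ (BodySat Tr ψ₁ i ∨ BodySat Tr ψ₂ i)
  | .next ψ => fun i => vac Tr i ∨ BodySat Tr ψ (i + 1)
  | .wuntil ψ₁ ψ₂ => fun i => vac Tr i ∨
      ((∃ j : ℕ, i ≤ j ∧ BodySat Tr ψ₂ j ∧ ∀ k : ℕ, i ≤ k → k < j → BodySat Tr ψ₁ k) ∨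
        ∀ j : ℕ, i ≤ j → BodySat Tr ψ₁ j)

/-- HyperLTL formulas: a quantifier prefix over trace variables followed by an
LTL body; `HyperLTL X n` has `n` already-bound (outer) trace variables. -/
inductive HyperLTL (X : Type) : ℕ → Type 1 where
  | body {n : ℕ} (ψ : LTLBody X n) : HyperLTL X n
  | uall {n : ℕ} (φ : HyperLTL X (n + 1)) : HyperLTL X n
  | uex {n : ℕ} (φ : HyperLTL X (n + 1)) : HyperLTL X n

/-- HyperLTL satisfaction `Π, 0 ⊨_T φ`, with quantifiers ranging over `T`. -/
def HSat {X : Type} (T : Set (Trace X)) :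
    {n : ℕ} → HyperLTL X n → (Fin n → Trace X) → Prop
  | _, .body ψ, Tr => BodySat Tr ψ 0
  | _, .uall φ, Tr => ∀ t ∈ T, HSat T φ (Fin.snoc Tr t)
  | _, .uex φ, Tr => ∃ t ∈ T, HSat T φ (Fin.snoc Tr t)

/-- `P ⊨ φ`, i.e., `∅, 0 ⊨_{Traces(P)} φ`. -/
def Sat {X : Type} [DecidableEq X] (P : Prog X) (φ : HyperLTL X 0) : Prop :=
  HSat (Traces P) φ Fin.elim0

/-- The formula is a `∀*` formula (all quantifiers universal). -/
def IsUniv {X : Type} : {n : ℕ} → HyperLTL X n → Prop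
  | _, .body _ => True
  | _, .uall φ => IsUniv φ
  | _, .uex _ => False

/-- The formula is an `∃*` formula (all quantifiers existential). -/
def IsExist {X : Type} : {n : ℕ} → HyperLTL X n → Prop
  | _, .body _ => True
  | _, .uall _ => False
  | _, .uex φ => IsExist φ

/-- Satisfaction of the `∀ⁿ` HyperLTL formula `∀π₁…∀πₙ. ψ` by program `P`. -/
def SatAll {X : Type} [DecidableEq X] (P : Prog X) {n : ℕ} (ψ : LTLBody X n) : Prop :=
  ∀ Tr : Fin n → Trace X, (∀ j, Tr j ∈ Traces P) → BodySat Tr ψ 0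

/-! ### The encodings -/

/-- The encoding `enc^φ_Ps`: each trace quantifier is resolved on the symbolic
paths in `Ps` (introducing a fresh copy of the program variables, i.e., a store,
and asserting the path condition on it); the body case asserts `acc^ψ_Δ`,
i.e., that the instantiated symbolic observation sequences satisfy `ψ`. -/
def enc {X : Type} (Ps : Set (SymPath X)) :
    {n : ℕ} → HyperLTL X n → (Fin n → Store X) → (Fin n → List (SymStore X)) → Prop
  | _, .body ψ, v, Δ => BodySat (fun j => evalTrace (Δ j) (v j)) ψ 0
  | _, .uall φ, v, Δ => ∀ σ : Store X, ∀ p ∈ Ps, p.1 σ →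
      enc Ps φ (Fin.snoc v σ) (Fin.snoc Δ p.2)
  | _, .uex φ, v, Δ => ∃ σ : Store X, ∃ p ∈ Ps, p.1 σ ∧
      enc Ps φ (Fin.snoc v σ) (Fin.snoc Δ p.2)

/-- The encoding `enc^φ_Ps` for the `∀ⁿ` formula `∀π₁…∀πₙ. ψ`. -/
def encAll {X : Type} {n : ℕ} (ψ : LTLBody X n) (Ps : Set (SymPath X)) : Prop :=
  ∀ (σs : Fin n → Store X) (ps : Fin n → SymPath X),
    (∀ j, ps j ∈ Ps) → (∀ j, (ps j).1 (σs j)) →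
    BodySat (fun j => evalTrace (ps j).2 (σs j)) ψ 0

/-- `t ≠_{X_out} t'`: at some position within both sequences the stores
differ on some output variable. -/
def OutDiff {X : Type} (Xout : Set X) (t t' : Trace X) : Prop :=
  ∃ i : ℕ, (i : ℕ∞) < t.len ∧ (i : ℕ∞) < t'.len ∧ ∃ x ∈ Xout, t.get i x ≠ t'.get i x

/-- `Q` is a fully transparent repair of `(P, ∀π₁…∀πₙ. ψ)`. -/
def FullyTransparent {X : Type} [DecidableEq X] (Xout : Set X) {n : ℕ}
    (ψ : LTLBody X n) (P Q : Prog X) : Prop :=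
  SatAll Q ψ ∧
  ∀ σ : Store X, OutDiff Xout (obsTrace P σ) (obsTrace Q σ) →
    ∃ σs : Fin n → Store X, (∃ j, σ = σs j) ∧
      ¬ BodySat (fun j => obsTrace P (σs j)) ψ 0

/-- `Q` is a better repair than `S` w.r.t. `(P, φ)`. -/
def BetterRepair {X : Type} [DecidableEq X] (Xout : Set X) (φ : HyperLTL X 0)
    (P Q S : Prog X) : Prop :=
  Sat Q φ ∧
  (∀ σ : Store X, OutDiff Xout (obsTrace P σ) (obsTrace Q σ) →
      OutDiff Xout (obsTrace P σ) (obsTrace S σ)) ∧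
  (∃ σ : Store X, OutDiff Xout (obsTrace P σ) (obsTrace S σ) ∧
      ¬ OutDiff Xout (obsTrace P σ) (obsTrace Q σ))

/-- The encoding `trans^φ_{Ps_P, Ps_Q}` for fully transparent repair
(for `φ = ∀π₁…∀πₙ. ψ`). -/
def transEnc {X : Type} (Xout : Set X) {n : ℕ} (ψ : LTLBody X n)
    (PP PQ : Set (SymPath X)) : Prop :=
  ∀ σ : Store X,
    (∃ pP ∈ PP, ∃ pQ ∈ PQ, pP.1 σ ∧ pQ.1 σ ∧
      ∃ i < min pP.2.length pQ.2.length, ∃ x ∈ Xout,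
        (pP.2.getD i initSym) x σ ≠ (pQ.2.getD i initSym) x σ) →
    ∃ (σs : Fin n → Store X) (ps : Fin n → SymPath X),
      (∀ j, ps j ∈ PP) ∧ (∀ j, (ps j).1 (σs j)) ∧ (∃ j, σ = σs j) ∧
      ¬ BodySat (fun j => evalTrace (ps j).2 (σs j)) ψ 0

/-- The encoding `iter_{Ps_P, Ps_S, Ps_Q}` for iterative repair. -/
def iterEnc {X : Type} (Xout : Set X) (PP PS PQ : Set (SymPath X)) : Prop :=
  (∀ σ : Store X, ∀ pP ∈ PP, ∀ pS ∈ PS, ∀ pQ ∈ PQ,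
    pP.1 σ → pS.1 σ → pQ.1 σ →
    (∃ i < min pP.2.length pQ.2.length, ∃ x ∈ Xout,
        (pP.2.getD i initSym) x σ ≠ (pQ.2.getD i initSym) x σ) →
    (∃ i < min pP.2.length pS.2.length, ∃ x ∈ Xout,
        (pP.2.getD i initSym) x σ ≠ (pS.2.getD i initSym) x σ)) ∧
  (∃ σ : Store X, ∃ pP ∈ PP, ∃ pS ∈ PS, ∃ pQ ∈ PQ,
    pP.1 σ ∧ pS.1 σ ∧ pQ.1 σ ∧
    (∃ i < min pP.2.length pS.2.length, ∃ x ∈ Xout,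
        (pP.2.getD i initSym) x σ ≠ (pS.2.getD i initSym) x σ) ∧
    (∀ i < min pP.2.length pQ.2.length, ∀ x ∈ Xout,
        (pP.2.getD i initSym) x σ = (pQ.2.getD i initSym) x σ))

/-- A program is loop-free if it contains no `while` statement. -/
def LoopFree {X : Type} : Prog X → Prop
  | .skip => True
  | .assign _ _ => True
  | .observe => True
  | .ite _ p q => LoopFree p ∧ LoopFree q
  | .whileLoop _ _ => False
  | .seq p q => LoopFree p ∧ LoopFree q

/-- `s` is a prefix of `t`. -/
def Trace.IsPrefix {X : Type} (s t : Trace X) : Prop :=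
  s.len ≤ t.len ∧ ∀ i : ℕ, (i : ℕ∞) < s.len → s.get i = t.get i

lemma vac.of_isPrefix {X : Type} {n : ℕ} {S T : Fin n → Trace X}
    (h : ∀ j, (S j).IsPrefix (T j)) {i : ℕ} : vac T i → vac S i :=
  fun ⟨j, hj⟩ => ⟨j, (h j).1.trans hj⟩

/-- Satisfaction of a body is inherited by prefixes. -/
lemma BodySat.of_isPrefix {X : Type} {n : ℕ} {S T : Fin n → Trace X}
    (h : ∀ j, (S j).IsPrefix (T j)) (ψ : LTLBody X n) :
    ∀ i, BodySat T ψ i → BodySat S ψ i := by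
  induction ψ with
  | atom θ =>
    intro i hT
    by_cases hv : vac S i
    · exact Or.inl hv
    · refine Or.inr ?_
      have hS : (fun j => (S j).get i) = fun j => (T j).get i :=
        funext fun j => (h j).2 i (not_le.1 fun hj => hv ⟨j, hj⟩)
      rw [hS]
      exact hT.resolve_left fun hvT => hv (vac.of_isPrefix h hvT)
  | and ψ₁ ψ₂ ih₁ ih₂ =>
    exact fun i => Or.imp (vac.of_isPrefix h) (And.imp (ih₁ i) (ih₂ i))
  | or ψ₁ ψ₂ ih₁ ih₂ =>
    exact fun i => Or.imp (vac.of_isPrefix h) (Or.imp (ih₁ i) (ih₂ i))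
  | next ψ ih =>
    exact fun i => Or.imp (vac.of_isPrefix h) (ih (i + 1))
  | wuntil ψ₁ ψ₂ ih₁ ih₂ =>
    refine fun i => Or.imp (vac.of_isPrefix h) (Or.imp ?_ ?_)
    · rintro ⟨j, hij, hj, hk⟩
      exact ⟨j, hij, ih₂ j hj, fun k hik hkj => ih₁ k (hk k hik hkj)⟩
    · exact fun hT j hij => ih₁ j (hT j hij)

section Run

variable {X : Type} [DecidableEq X]

/-- The small-step semantics as a partial function. -/
def stepFn : Prog X → Store X → Option (Option (Store X) × Config X)
  | .skip, _ => none
  | .assign x e, σ => some (none, .skip, Function.update σ x (e σ))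
  | .observe, σ => some (some σ, .skip, σ)
  | .ite b p q, σ => some (none, if b σ then p else q, σ)
  | .whileLoop b p, σ => some (none, if b σ then .seq p (.whileLoop b p) else .skip, σ)
  | .seq p q, σ =>
    match stepFn p σ with
    | none => some (none, q, σ)
    | some (l, p', σ') => some (l, .seq p' q, σ')

lemma stepFn_eq_none {p : Prog X} {σ : Store X} : stepFn p σ = none ↔ p = .skip := by
  cases p <;> simp only [stepFn, reduceCtorEq]
  split <;> simp

lemma step_of_stepFn {p : Prog X} : ∀ {σ : Store X} {l : Option (Store X)} {C : Config X},
    stepFn p σ = some (l, C) → Step (p, σ) l C := by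
  induction p with
  | skip => intro σ l C h; simp [stepFn] at h
  | assign x e =>
    intro σ l C h
    simp only [stepFn, Option.some.injEq, Prod.mk.injEq] at h
    obtain ⟨rfl, rfl⟩ := h
    exact .assign
  | observe =>
    intro σ l C h
    simp only [stepFn, Option.some.injEq, Prod.mk.injEq] at h
    obtain ⟨rfl, rfl⟩ := h
    exact .observe
  | ite b p q _ _ =>
    intro σ l C h
    simp only [stepFn, Option.some.injEq, Prod.mk.injEq] at h
    obtain ⟨rfl, rfl⟩ := h
    cases hb : b σ
    · simpa using Step.iteFalse hb
    · simpa using Step.iteTrue hb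
  | whileLoop b p _ =>
    intro σ l C h
    simp only [stepFn, Option.some.injEq, Prod.mk.injEq] at h
    obtain ⟨rfl, rfl⟩ := h
    cases hb : b σ
    · simpa using Step.whileFalse hb
    · simpa using Step.whileTrue hb
  | seq p q ihp _ =>
    intro σ l C h
    cases hp : stepFn p σ with
    | none =>
      simp only [stepFn, hp, Option.some.injEq, Prod.mk.injEq] at h
      obtain ⟨rfl, rfl⟩ := h
      rw [stepFn_eq_none] at hp
      subst hp
      exact .seqSkip
    | some r =>
      obtain ⟨l', p', σ'⟩ := r
      simp only [stepFn, hp, Option.some.injEq, Prod.mk.injEq] at h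
      obtain ⟨rfl, rfl⟩ := h
      exact .seqStep (ihp hp)

/-- The configuration reached from `C` after `n` steps (staying put at `skip`). -/
def runCfg (C : Config X) : ℕ → Config X
  | 0 => C
  | n + 1 => (stepFn (runCfg C n).1 (runCfg C n).2).elim (runCfg C n) Prod.snd

/-- The label of the `n`-th step of the run from `C`. -/
def runLbl (C : Config X) (n : ℕ) : Option (Store X) :=
  (stepFn (runCfg C n).1 (runCfg C n).2).elim none Prod.fst

lemma runCfg_fst_eq_skip_of_le {C : Config X} {m n : ℕ} (hmn : m ≤ n)
    (h : (runCfg C m).1 = .skip) : (runCfg C n).1 = .skip := by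
  induction n, hmn using Nat.le_induction with
  | base => exact h
  | succ n _ ih =>
    rw [runCfg, stepFn_eq_none.2 ih]
    exact ih

open Classical in
/-- The maximal execution from `C`. -/
noncomputable def maxExec (C : Config X) : Exec C where
  len := if h : ∃ n, (runCfg C n).1 = .skip then (Nat.find h : ℕ∞) else ⊤
  cfg := runCfg C
  lbl := runLbl C
  init := rfl
  step := by
    intro i hi
    have hns : (runCfg C i).1 ≠ .skip := by
      intro hs
      have hex : ∃ n, (runCfg C n).1 = .skip := ⟨i, hs⟩
      rw [dif_pos hex] at hi
      have h₁ : i + 1 ≤ Nat.find hex := by exact_mod_cast hi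
      have h₂ := Nat.find_min' hex hs
      omega
    obtain ⟨⟨l, C'⟩, hr⟩ := Option.ne_none_iff_exists'.1
      (mt (stepFn_eq_none (σ := (runCfg C i).2)).1 hns)
    rw [runCfg, runLbl, hr]
    exact step_of_stepFn hr

lemma maxExec_maximal (C : Config X) : (maxExec C).Maximal := by
  classical
  by_cases h : ∃ n, (runCfg C n).1 = .skip
  · exact Or.inr ⟨Nat.find h, by simp only [maxExec, dif_pos h], Nat.find_spec h⟩
  · exact Or.inl (by simp only [maxExec, dif_neg h])

lemma maxExec_obsIdx (C : Config X) :
    (maxExec C).ObsIdx = fun i => (runLbl C i).isSome = true := by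
  classical
  funext i
  refine propext ⟨fun h => h.2, fun h => ⟨?_, h⟩⟩
  by_cases hex : ∃ n, (runCfg C n).1 = .skip
  · simp only [maxExec, dif_pos hex]
    have hi : i < Nat.find hex := by
      rw [Nat.lt_find_iff]
      intro m hm hs
      simp [runLbl, stepFn_eq_none.2 (runCfg_fst_eq_skip_of_le hm hs)] at h
    exact_mod_cast hi
  · simp only [maxExec, dif_neg hex, le_top]

end Run

lemma length_filterMap_range {A : Type} (f : ℕ → Option A) (n : ℕ) :
    ((List.range n).filterMap f).length = Nat.count (fun i => (f i).isSome = true) n := by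
  induction n with
  | zero => simp
  | succ n ih =>
    rw [List.range_succ, List.filterMap_append, List.length_append, ih, Nat.count_succ]
    cases h : f n <;> simp [h]

lemma getElem?_filterMap_range {A : Type} (f : ℕ → Option A) (n k : ℕ)
    (hk : k < ((List.range n).filterMap f).length) :
    ((List.range n).filterMap f)[k]? = f (Nat.nth (fun i => (f i).isSome = true) k) := by
  induction n with
  | zero => simp at hk
  | succ n ih =>
    rw [List.range_succ, List.filterMap_append] at hk ⊢
    by_cases hlt : k < ((List.range n).filterMap f).length
    · rw [List.getElem?_append_left hlt, ih hlt]
    · cases hf : f n with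
      | none => simp [hf] at hk; simp at hlt; omega
      | some a =>
        have hke : k = ((List.range n).filterMap f).length := by
          simp only [List.length_append, List.filterMap_cons, hf, List.filterMap_nil,
            List.length_singleton] at hk
          omega
        have hn : Nat.nth (fun i => (f i).isSome = true) k = n := by
          rw [hke, length_filterMap_range]
          exact Nat.nth_count (p := fun i => (f i).isSome = true) (by simp [hf])
        rw [hn, hf, hke]
        simp [hf]

section Symbolic

variable {X : Type} [DecidableEq X]

lemma SymStep.stepFn_eq {c c' : SymConfig X} (h : SymStep c c') {σ : Store X}
    (hα : c'.2.2.1 σ) : c.2.2.1 σ ∧ ∃ l : Option (Store X),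
      stepFn c.1 (fun x => c.2.1 x σ) = some (l, c'.1, fun x => c'.2.1 x σ) ∧
      evalObs c'.2.2.2 σ = evalObs c.2.2.2 σ ++ l.toList := by
  induction h with
  | assign =>
    refine ⟨hα, none, ?_, by simp⟩
    simp only [stepFn, Option.some.injEq, Prod.mk.injEq, true_and]
    funext y
    simp only [Function.update_apply]
    split <;> simp [symEvalA]
  | observe => exact ⟨hα, some _, rfl, by simp [evalObs]⟩
  | @iteTrue b _ _ ν =>
    have hb : b (fun x => ν x σ) = true := hα.2
    exact ⟨hα.1, none, by simp [stepFn, hb], by simp⟩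
  | @iteFalse b _ _ ν =>
    have hb : b (fun x => ν x σ) = false := hα.2
    exact ⟨hα.1, none, by simp [stepFn, hb], by simp⟩
  | @whileTrue b _ ν =>
    have hb : b (fun x => ν x σ) = true := hα.2
    exact ⟨hα.1, none, by simp [stepFn, hb], by simp⟩
  | @whileFalse b _ ν =>
    have hb : b (fun x => ν x σ) = false := hα.2
    exact ⟨hα.1, none, by simp [stepFn, hb], by simp⟩
  | seqSkip => exact ⟨hα, none, rfl, by simp⟩
  | seqStep _ ih =>
    obtain ⟨h₁, l, h₂, h₃⟩ := ih hα
    exact ⟨h₁, l, by simp only [stepFn, h₂], h₃⟩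

/-- A symbolic execution is followed by the concrete run from every store that
satisfies its path condition. -/
lemma exists_runCfg_of_symSteps {P : Prog X} {c : SymConfig X} {σ : Store X}
    (h : Relation.ReflTransGen SymStep (P, initSym, fun _ => True, []) c) (hα : c.2.2.1 σ) :
    ∃ n, runCfg (P, σ) n = (c.1, fun x => c.2.1 x σ) ∧
      (List.range n).filterMap (runLbl (P, σ)) = evalObs c.2.2.2 σ := by
  induction h with
  | refl => exact ⟨0, rfl, rfl⟩
  | tail _ hstep ih =>
    obtain ⟨hα', l, hfn, hobs⟩ := hstep.stepFn_eq hα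
    obtain ⟨n, hn, hL⟩ := ih hα'
    refine ⟨n + 1, by simp [runCfg, hn, hfn], ?_⟩
    have hl : runLbl (P, σ) n = l := by simp [runLbl, hn, hfn]
    rw [List.range_succ, List.filterMap_append, hL, hobs]
    cases l <;> simp [hl]

/-- Instantiating a symbolic path yields a prefix of some trace of the program. -/
lemma exists_mem_traces_isPrefix {P : Prog X} {p : SymPath X} (hp : IsSymPath P p)
    {σ : Store X} (hσ : p.1 σ) : ∃ t ∈ Traces P, (evalTrace p.2 σ).IsPrefix t := by
  classical
  obtain ⟨P', ν, hrun⟩ := hp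
  obtain ⟨n, -, hL⟩ := exists_runCfg_of_symSteps hrun hσ
  have hlen : ((List.range n).filterMap (runLbl (P, σ))).length = p.2.length := by
    rw [hL]; simp [evalObs]
  refine ⟨_, ⟨σ, maxExec (P, σ), maxExec_maximal _, rfl⟩, ?_, ?_⟩
  · simp only [evalTrace, Exec.obs, maxExec_obsIdx]
    split_ifs with hfin
    · rw [← hlen, length_filterMap_range, Nat.count_eq_card_filter_range]
      refine Nat.cast_le.2 (Finset.card_le_card fun i hi => ?_)
      simpa using (Finset.mem_filter.1 hi).2
    · exact le_top
  · intro i hi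
    have hi' : i < p.2.length := by simpa [evalTrace] using hi
    have hget := getElem?_filterMap_range (runLbl (P, σ)) n i (hlen ▸ hi')
    rw [hL] at hget
    simp only [Exec.obs, maxExec_obsIdx]
    change _ = (runLbl (P, σ) _).getD _
    rw [← hget]
    simp [evalTrace, evalObs, hi']

lemma enc_of_hSat {P : Prog X} {Ps : Set (SymPath X)} (hsub : Ps ⊆ SymPaths P) {n : ℕ}
    (φ : HyperLTL X n) : IsUniv φ → ∀ {Tr : Fin n → Trace X} {v : Fin n → Store X}
      {Δ : Fin n → List (SymStore X)}, (∀ j, (evalTrace (Δ j) (v j)).IsPrefix (Tr j)) →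
      HSat (Traces P) φ Tr → enc Ps φ v Δ := by
  induction φ with
  | body ψ => exact fun _ _ _ _ hpre => BodySat.of_isPrefix hpre ψ 0
  | uall φ ih =>
    intro hu Tr v Δ hpre hsat σ p hp hσ
    obtain ⟨t, ht, hpt⟩ := exists_mem_traces_isPrefix (hsub hp).1 hσ
    refine ih hu (fun j => ?_) (hsat t ht)
    refine Fin.lastCases ?_ (fun j => ?_) j
    · simpa using hpt
    · simpa using hpre j
  | uex φ _ => exact fun hu => hu.elim

end Symbolic

/-- Proposition 3. For a `∀*` HyperLTL formula `φ` and a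
finite set `𝒫 ⊆ SymPaths(Q)` of satisfiable (not necessarily maximal) symbolic
paths: if `enc^φ_𝒫` is not valid then `Q ⊭ φ`. -/
theorem enc_forall_refute {X : Type} [DecidableEq X] (Q : Prog X)
    (φ : HyperLTL X 0) (huniv : IsUniv φ) (Ps : Set (SymPath X))
    (hsub : Ps ⊆ SymPaths Q) (hfin : Ps.Finite)
    (henc : ¬ enc Ps φ Fin.elim0 Fin.elim0) : ¬ Sat Q φ :=
  fun h => henc (enc_of_hSat hsub φ huniv (fun j => j.elim0) h)

end HyRep
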